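/- Let -D/2 ≤ x_C < x_B ≤ D/2 and let (r̄1, r̄2) be the unique intersection point of the Pareto boundary functions of C_f(x_B) and C_f(x_C), i.e., the unique point with 0 < r̄1 < log2(1 + P̄ h1(x_B)) and R2^B(r̄1) = R2^C(r̄1) = r̄2, where R2^m(s) = sup{ r2 : (s, r2) ∈ C_f(x_m) }. Suppose (r1B, r2B) ∈ C_f(x_B) and (r1C, r2C) ∈ C_f(x_C) with r1B ≠ r1C are points such that the line through them supports Conv( C_f(x_B) ∪ C_f(x_C) ) from above, i.e., every (s1, s2) ∈ C_f(x_B) ∪ C_f(x_C) satisfies s2 ≤ k·(s1 − r1B) + r2B with k = (r2B − r2C)/(r1B − r1C). Then 0 ≤ r1B < r̄1 < r1C and 0 ≤ r2C < r̄2 < r2B. -/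

import Mathlib

/-- Channel power gain (normalized by noise) from the UAV at horizontal position `x`
to ground user 1 located at `-D/2`. -/
noncomputable def h1 (D H β0 x : ℝ) : ℝ := β0 / ((x + D / 2) ^ 2 + H ^ 2)

/-- Channel power gain from the UAV at horizontal position `x` to ground user 2
located at `D/2`. -/
noncomputable def h2 (D H β0 x : ℝ) : ℝ := β0 / ((x - D / 2) ^ 2 + H ^ 2)

/-- The fixed-location MAC-form region `C_MAC(x, p1, p2)`. -/
noncomputable def CMAC (D H β0 : ℝ) (x p1 p2 : ℝ) : Set (ℝ × ℝ) :=
  {r | 0 ≤ r.1 ∧ 0 ≤ r.2 ∧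
    r.1 ≤ Real.logb 2 (1 + p1 * h1 D H β0 x) ∧
    r.2 ≤ Real.logb 2 (1 + p2 * h2 D H β0 x) ∧
    r.1 + r.2 ≤ Real.logb 2 (1 + p1 * h1 D H β0 x + p2 * h2 D H β0 x)}

/-- The fixed-location capacity region `C_f(x)`: the union of `C_MAC(x, p1, p2)`
over all power splits `p1, p2 ≥ 0` with `p1 + p2 ≤ P`. -/
noncomputable def Cf (D H β0 P : ℝ) (x : ℝ) : Set (ℝ × ℝ) :=
  {r | ∃ p1 p2 : ℝ, 0 ≤ p1 ∧ 0 ≤ p2 ∧ p1 + p2 ≤ P ∧ r ∈ CMAC D H β0 x p1 p2}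

/-- The Pareto boundary function of `C_f(x)`: the largest `r2` such that
`(s, r2) ∈ C_f(x)`. -/
noncomputable def R2 (D H β0 P : ℝ) (x s : ℝ) : ℝ :=
  sSup {r2 : ℝ | (s, r2) ∈ Cf D H β0 P x}

/-- Numerator of the exponentiated Pareto boundary for channel gains `a`, `b`. -/
noncomputable def bdNum (a b P s : ℝ) : ℝ :=
  max a b + a * b * P - (b - min a b) * (2 : ℝ) ^ s

/-- Denominator of the exponentiated Pareto boundary for channel gains `a`, `b`. -/
noncomputable def bdDen (a b s : ℝ) : ℝ := min a b * (2 : ℝ) ^ s + (a - min a b)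

/-- Closed form of the Pareto boundary for channel gains `a`, `b`. -/
noncomputable def bd (a b P s : ℝ) : ℝ := Real.logb 2 (bdNum a b P s / bdDen a b s)

theorem exists_power_split_iff {a b P S T : ℝ} (ha : 0 < a) (hb : 0 < b)
    (hS : 1 ≤ S) (hT : 1 ≤ T) :
    (∃ p1 p2 : ℝ, 0 ≤ p1 ∧ 0 ≤ p2 ∧ p1 + p2 ≤ P ∧
      S ≤ 1 + p1 * a ∧ T ≤ 1 + p2 * b ∧ S * T ≤ 1 + p1 * a + p2 * b) ↔
    T * (min a b * S + (a - min a b)) ≤ max a b + a * b * P - (b - min a b) * S := by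
  constructor
  · rintro ⟨p1, p2, -, -, hp, hp1, hp2, hp3⟩
    have hab := mul_le_mul_of_nonneg_left hp (mul_pos ha hb).le
    rcases le_total a b with h | h
    · rw [min_eq_left h, max_eq_right h]
      have := mul_le_mul_of_nonneg_left hp1 (sub_nonneg.2 h)
      have := mul_le_mul_of_nonneg_left hp3 ha.le
      nlinarith
    · rw [min_eq_right h, max_eq_left h]
      have := mul_le_mul_of_nonneg_left hp2 (sub_nonneg.2 h)
      have := mul_le_mul_of_nonneg_left hp3 hb.le
      nlinarith
  · intro hle
    rcases le_total a b with h | h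
    · rw [min_eq_left h, max_eq_right h] at hle
      have hp1 : (S - 1) / a * a = S - 1 := div_mul_cancel₀ _ ha.ne'
      set p1 := (S - 1) / a
      have hSa : S = 1 + p1 * a := by linarith
      have hp1_nonneg : 0 ≤ p1 := div_nonneg (by linarith) ha.le
      have hsum : S * T ≤ 1 + p1 * a + (P - p1) * b := by
        refine le_of_mul_le_mul_left ?_ ha
        rw [hSa] at hle ⊢
        nlinarith
      have hp : 0 ≤ P - p1 := by
        have : 0 ≤ (P - p1) * b := by nlinarith
        exact nonneg_of_mul_nonneg_left this hb
      refine ⟨p1, P - p1, hp1_nonneg, hp, by linarith, hSa.le, ?_, hsum⟩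
      have : S * (T - 1) ≤ (P - p1) * b := by nlinarith
      nlinarith
    · rw [min_eq_right h, max_eq_left h] at hle
      have hp2 : (T - 1) / b * b = T - 1 := div_mul_cancel₀ _ hb.ne'
      set p2 := (T - 1) / b
      have hTb : T = 1 + p2 * b := by linarith
      have hp2_nonneg : 0 ≤ p2 := div_nonneg (by linarith) hb.le
      have hsum : S * T ≤ 1 + (P - p2) * a + p2 * b := by
        refine le_of_mul_le_mul_left ?_ hb
        rw [hTb] at hle ⊢
        nlinarith
      have hp : 0 ≤ P - p2 := by
        have : 0 ≤ (P - p2) * a := by nlinarith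
        exact nonneg_of_mul_nonneg_left this ha
      refine ⟨P - p2, p2, hp, hp2_nonneg, by linarith, ?_, hTb.le, hsum⟩
      have : (S - 1) * T ≤ (P - p2) * a := by nlinarith
      nlinarith

theorem h1_pos {H β0 : ℝ} (hH : 0 < H) (hβ : 0 < β0) (D x : ℝ) : 0 < h1 D H β0 x := by
  unfold h1; positivity

theorem h2_pos {H β0 : ℝ} (hH : 0 < H) (hβ : 0 < β0) (D x : ℝ) : 0 < h2 D H β0 x := by
  unfold h2; positivity

theorem mem_Cf_iff {D H β0 P x s t : ℝ} (hH : 0 < H) (hβ : 0 < β0) :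
    (s, t) ∈ Cf D H β0 P x ↔ 0 ≤ s ∧ 0 ≤ t ∧
      (2 : ℝ) ^ t * bdDen (h1 D H β0 x) (h2 D H β0 x) s ≤
        bdNum (h1 D H β0 x) (h2 D H β0 x) P s := by
  have ha := h1_pos hH hβ D x
  have hb := h2_pos hH hβ D x
  have key : ∀ {r y : ℝ}, 0 < y → (r ≤ Real.logb 2 y ↔ (2 : ℝ) ^ r ≤ y) := fun hy =>
    Real.le_logb_iff_rpow_le one_lt_two hy
  constructor
  · rintro ⟨p1, p2, hp1, hp2, hp, hs, ht, h₁, h₂, h₃⟩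
    dsimp only at hs ht h₁ h₂ h₃
    rw [key (by positivity)] at h₁ h₂ h₃
    rw [Real.rpow_add two_pos] at h₃
    exact ⟨hs, ht, (exists_power_split_iff ha hb (Real.one_le_rpow one_le_two hs)
      (Real.one_le_rpow one_le_two ht)).1 ⟨p1, p2, hp1, hp2, hp, h₁, h₂, h₃⟩⟩
  · rintro ⟨hs, ht, hle⟩
    obtain ⟨p1, p2, hp1, hp2, hp, h₁, h₂, h₃⟩ := (exists_power_split_iff ha hb
      (Real.one_le_rpow one_le_two hs) (Real.one_le_rpow one_le_two ht)).2 hle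
    refine ⟨p1, p2, hp1, hp2, hp, hs, ht, ?_, ?_, ?_⟩ <;> dsimp only <;>
      rw [key (by positivity)]
    · exact h₁
    · exact h₂
    · rwa [Real.rpow_add two_pos]

theorem bdDen_pos {a b s : ℝ} (ha : 0 < a) (hb : 0 < b) : 0 < bdDen a b s := by
  have := min_le_left a b
  have : 0 < min a b * (2 : ℝ) ^ s := mul_pos (lt_min ha hb) (Real.rpow_pos_of_pos two_pos _)
  unfold bdDen; linarith

theorem bdNum_sub_bdDen (a b P s : ℝ) :
    bdNum a b P s - bdDen a b s = b * (1 + P * a - (2 : ℝ) ^ s) := by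
  have := min_add_max a b
  unfold bdNum bdDen
  linear_combination this

theorem bdDen_le_bdNum_iff {a b P s : ℝ} (ha : 0 < a) (hb : 0 < b) (hP : 0 < P) :
    bdDen a b s ≤ bdNum a b P s ↔ s ≤ Real.logb 2 (1 + P * a) := by
  rw [← sub_nonneg, bdNum_sub_bdDen, mul_nonneg_iff_of_pos_left hb, sub_nonneg,
    Real.le_logb_iff_rpow_le one_lt_two (by positivity)]

theorem bdNum_pos {a b P s : ℝ} (ha : 0 < a) (hb : 0 < b) (hP : 0 < P)
    (hs : s ≤ Real.logb 2 (1 + P * a)) : 0 < bdNum a b P s :=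
  (bdDen_pos ha hb).trans_le ((bdDen_le_bdNum_iff ha hb hP).2 hs)

theorem bd_nonneg {a b P s : ℝ} (ha : 0 < a) (hb : 0 < b) (hP : 0 < P)
    (hs : s ≤ Real.logb 2 (1 + P * a)) : 0 ≤ bd a b P s :=
  Real.logb_nonneg one_lt_two
    ((one_le_div (bdDen_pos ha hb)).2 ((bdDen_le_bdNum_iff ha hb hP).2 hs))

theorem le_bd_iff {a b P s t : ℝ} (ha : 0 < a) (hb : 0 < b) (hP : 0 < P)
    (hs : s ≤ Real.logb 2 (1 + P * a)) :
    t ≤ bd a b P s ↔ (2 : ℝ) ^ t * bdDen a b s ≤ bdNum a b P s := by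
  rw [bd, Real.le_logb_iff_rpow_le one_lt_two
    (div_pos (bdNum_pos ha hb hP hs) (bdDen_pos ha hb)), le_div_iff₀ (bdDen_pos ha hb)]

theorem mem_Cf_iff_le_bd {D H β0 P x s t : ℝ} (hH : 0 < H) (hβ : 0 < β0) (hP : 0 < P) :
    (s, t) ∈ Cf D H β0 P x ↔ 0 ≤ s ∧ s ≤ Real.logb 2 (1 + P * h1 D H β0 x) ∧ 0 ≤ t ∧
      t ≤ bd (h1 D H β0 x) (h2 D H β0 x) P s := by
  have ha := h1_pos hH hβ D x
  have hb := h2_pos hH hβ D x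
  rw [mem_Cf_iff hH hβ]
  constructor
  · rintro ⟨hs, ht, hle⟩
    have hL : s ≤ Real.logb 2 (1 + P * h1 D H β0 x) :=
      (bdDen_le_bdNum_iff ha hb hP).1 <|
        (le_mul_of_one_le_left (bdDen_pos ha hb).le (Real.one_le_rpow one_le_two ht)).trans hle
    exact ⟨hs, hL, ht, (le_bd_iff ha hb hP hL).2 hle⟩
  · rintro ⟨hs, hL, ht, hle⟩
    exact ⟨hs, ht, (le_bd_iff ha hb hP hL).1 hle⟩

theorem R2_eq_bd {D H β0 P x s : ℝ} (hH : 0 < H) (hβ : 0 < β0) (hP : 0 < P) (hs : 0 ≤ s)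
    (hL : s ≤ Real.logb 2 (1 + P * h1 D H β0 x)) :
    R2 D H β0 P x s = bd (h1 D H β0 x) (h2 D H β0 x) P s := by
  have hset : {r2 : ℝ | (s, r2) ∈ Cf D H β0 P x} =
      Set.Icc 0 (bd (h1 D H β0 x) (h2 D H β0 x) P s) := by
    ext t
    simp only [Set.mem_ofPred_eq, mem_Cf_iff_le_bd hH hβ hP, Set.mem_Icc]
    tauto
  rw [R2, hset, csSup_Icc (bd_nonneg (h1_pos hH hβ D x) (h2_pos hH hβ D x) hP hL)]

theorem hasDerivAt_bd {a b P s : ℝ} (ha : 0 < a) (hb : 0 < b) (hP : 0 < P)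
    (hs : s ≤ Real.logb 2 (1 + P * a)) :
    HasDerivAt (bd a b P) (-((2 : ℝ) ^ s *
      ((b - min a b) / bdNum a b P s + min a b / bdDen a b s))) s := by
  have hN := bdNum_pos ha hb hP hs
  have hD := bdDen_pos (s := s) ha hb
  have hlog : Real.log 2 ≠ 0 := (Real.log_pos one_lt_two).ne'
  have hpow : HasDerivAt (fun s : ℝ => (2 : ℝ) ^ s) ((2 : ℝ) ^ s * Real.log 2) s := by
    simpa [mul_comm] using (hasDerivAt_id s).const_rpow two_pos
  have hN' : HasDerivAt (bdNum a b P) _ s :=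
    (hpow.const_mul (b - min a b)).const_sub (max a b + a * b * P)
  have hD' : HasDerivAt (bdDen a b) _ s := (hpow.const_mul (min a b)).add_const (a - min a b)
  have h := ((hN'.div hD' hD.ne').log (div_pos hN hD).ne').div_const (Real.log 2)
  refine h.congr_deriv ?_
  simp only [Pi.div_apply]
  field_simp
  ring

theorem strictAntiOn_bd {a b P : ℝ} (ha : 0 < a) (hb : 0 < b) (hP : 0 < P) :
    StrictAntiOn (bd a b P) (Set.Iic (Real.logb 2 (1 + P * a))) := by
  intro s hs t ht hst
  have hpow : (2 : ℝ) ^ s < (2 : ℝ) ^ t := Real.rpow_lt_rpow_of_exponent_lt one_lt_two hst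
  have hD : bdDen a b s < bdDen a b t := by
    have := mul_lt_mul_of_pos_left hpow (lt_min ha hb)
    unfold bdDen; linarith
  have hN : bdNum a b P t ≤ bdNum a b P s := by
    have := mul_le_mul_of_nonneg_left hpow.le (sub_nonneg.2 (min_le_right a b))
    unfold bdNum; linarith
  refine Real.logb_lt_logb one_lt_two (div_pos (bdNum_pos ha hb hP ht) (bdDen_pos ha hb)) ?_
  exact div_lt_div₀' hN hD (bdNum_pos ha hb hP hs) (bdDen_pos ha hb)

theorem continuousOn_bd {a b P : ℝ} (ha : 0 < a) (hb : 0 < b) (hP : 0 < P) :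
    ContinuousOn (bd a b P) (Set.Iic (Real.logb 2 (1 + P * a))) := fun _ hs =>
  (hasDerivAt_bd ha hb hP hs).continuousAt.continuousWithinAt

theorem bd_zero {a b P : ℝ} (ha : 0 < a) : bd a b P 0 = Real.logb 2 (1 + P * b) := by
  have := min_add_max a b
  have hD : bdDen a b 0 = a := by simp [bdDen]
  have hN : bdNum a b P 0 = a * (1 + P * b) := by
    simp only [bdNum, Real.rpow_zero]; linear_combination this
  rw [bd, hD, hN, mul_div_cancel_left₀ _ ha.ne']

theorem bd_logb {a b P : ℝ} (ha : 0 < a) (hb : 0 < b) (hP : 0 < P) :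
    bd a b P (Real.logb 2 (1 + P * a)) = 0 := by
  have h := bdNum_sub_bdDen a b P (Real.logb 2 (1 + P * a))
  rw [Real.rpow_logb two_pos (by norm_num) (by positivity), sub_self, mul_zero, sub_eq_zero] at h
  rw [bd, h, div_self (bdDen_pos ha hb).ne', Real.logb_one]

/-- Where two boundaries meet, the one favouring user 2 is strictly steeper. -/
theorem bd_slope_lt_of_bd_eq {a b a' b' P s : ℝ} (ha : 0 < a) (hb' : 0 < b') (hP : 0 < P)
    (haa : a < a') (hbb : b' < b) (hs : s ≤ Real.logb 2 (1 + P * a))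
    (hs' : s ≤ Real.logb 2 (1 + P * a')) (heq : bd a b P s = bd a' b' P s) :
    (b' - min a' b') / bdNum a' b' P s + min a' b' / bdDen a' b' s <
      (b - min a b) / bdNum a b P s + min a b / bdDen a b s := by
  have ha' := ha.trans haa
  have hb := hb'.trans hbb
  have hD := bdDen_pos (s := s) ha hb
  have hD' := bdDen_pos (s := s) ha' hb'
  have hN := bdNum_pos ha hb hP hs
  have hN' := bdNum_pos ha' hb' hP hs'
  have hT := Real.logb_injOn_pos one_lt_two (div_pos hN hD) (div_pos hN' hD') heq
  obtain ⟨T, hT_def⟩ : ∃ T, T = bdNum a b P s / bdDen a b s := ⟨_, rfl⟩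
  have hT_pos : 0 < T := hT_def ▸ div_pos hN hD
  have hN_eq : bdNum a b P s = T * bdDen a b s := by rw [hT_def, div_mul_cancel₀ _ hD.ne']
  have hN'_eq : bdNum a' b' P s = T * bdDen a' b' s := by
    rw [hT_def, hT, div_mul_cancel₀ _ hD'.ne']
  have hS : 0 < (2 : ℝ) ^ s := Real.rpow_pos_of_pos two_pos _
  have hrw : ∀ {m c d : ℝ}, 0 < d → (c - m) / (T * d) + m / d = (c - m + m * T) / (T * d) := by
    intro m c d hd
    field_simp
  rw [hN_eq, hN'_eq, hrw hD, hrw hD', div_lt_div_iff₀ (by positivity) (by positivity)]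
  suffices h : (b' - min a' b' + min a' b' * T) * bdDen a b s <
      (b - min a b + min a b * T) * bdDen a' b' s by nlinarith
  unfold bdDen
  generalize (2 : ℝ) ^ s = S at hS
  have hTS : 0 < T * S := mul_pos hT_pos hS
  have hprod : a * b' < a' * b := mul_lt_mul'' haa hbb ha.le hb'.le
  rcases le_total a b with h | h <;> rcases le_total a' b' with h' | h'
  · simp only [min_eq_left h, min_eq_left h', sub_self, add_zero]
    nlinarith [mul_lt_mul_of_pos_right hprod hS]
  · simp only [min_eq_left h, min_eq_right h', sub_self, add_zero, zero_add]
    have h₁ : 0 ≤ (b - a) * (a' - b') := mul_nonneg (by linarith) (by linarith)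
    rcases h.lt_or_eq with h₂ | h₂
    · nlinarith [mul_pos (mul_pos (sub_pos.2 h₂) hb') hS,
        mul_nonneg (mul_nonneg ha.le (sub_nonneg.2 h')) hT_pos.le]
    · have h₃ : b' < a' := by linarith
      nlinarith [mul_nonneg (mul_nonneg (sub_nonneg.2 h) hb'.le) hS.le,
        mul_pos (mul_pos ha (sub_pos.2 h₃)) hT_pos]
  · linarith
  · simp only [min_eq_right h, min_eq_right h', sub_self, zero_add]
    nlinarith [mul_lt_mul_of_pos_right hprod hT_pos]

theorem h1_lt_h1 {D H β0 x y : ℝ} (hH : 0 < H) (hβ : 0 < β0) (hx : -(D / 2) ≤ x)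
    (hxy : x < y) : h1 D H β0 y < h1 D H β0 x := by
  unfold h1
  exact div_lt_div_of_pos_left hβ (by positivity) (by nlinarith)

theorem h2_lt_h2 {D H β0 x y : ℝ} (hH : 0 < H) (hβ : 0 < β0) (hy : y ≤ D / 2)
    (hxy : x < y) : h2 D H β0 x < h2 D H β0 y := by
  unfold h2
  exact div_lt_div_of_pos_left hβ (by positivity) (by nlinarith)

/-- A differentiable function lying below a line near a touching point has the slope of that line. -/
theorem HasDerivAt.eq_slope_of_le_line {f : ℝ → ℝ} {f' k c x₀ l u : ℝ} (hf : HasDerivAt f f' x₀)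
    (hl : l < x₀) (hu : x₀ < u) (htouch : f x₀ = k * x₀ + c)
    (hle : ∀ s ∈ Set.Ioo l u, f s ≤ k * s + c) : f' = k := by
  have hmax : IsLocalMax (fun s => f s - k * s) x₀ := by
    filter_upwards [Ioo_mem_nhds hl hu] with s hs
    have := hle s hs
    linarith
  have hd : HasDerivAt (fun s => f s - k * s) (f' - k * 1) x₀ :=
    hf.sub ((hasDerivAt_id x₀).const_mul k)
  have := hmax.hasDerivAt_eq_zero hd
  linarith

/-- (Lemma 7.) Let `-D/2 ≤ xC < xB ≤ D/2` and let `(r̄1, r̄2)`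
be the unique intersection point of the Pareto boundary functions of `C_f(xB)`
and `C_f(xC)`. If `(r1B, r2B) ∈ C_f(xB)` and `(r1C, r2C) ∈ C_f(xC)` with
`r1B ≠ r1C` are the tangency points of the common upper tangent of
`Conv(C_f(xB) ∪ C_f(xC))`, then `0 ≤ r1B < r̄1 < r1C` and
`0 ≤ r2C < r̄2 < r2B`. -/
theorem tangent_points_straddle_intersection
    (D H β0 P xB xC rb1 rb2 r1B r2B r1C r2C : ℝ)
    (hD : 0 < D) (hH : 0 < H) (hβ : 0 < β0) (hP : 0 < P)
    (hC : -(D / 2) ≤ xC) (hCB : xC < xB) (hB : xB ≤ D / 2)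
    (hrb1_pos : 0 < rb1) (hrb1_lt : rb1 < Real.logb 2 (1 + P * h1 D H β0 xB))
    (hint : R2 D H β0 P xB rb1 = R2 D H β0 P xC rb1)
    (hrb2 : rb2 = R2 D H β0 P xB rb1)
    (huniq : ∀ s : ℝ, 0 < s → s < Real.logb 2 (1 + P * h1 D H β0 xB) →
      R2 D H β0 P xB s = R2 D H β0 P xC s → s = rb1)
    (hmemB : (r1B, r2B) ∈ Cf D H β0 P xB)
    (hmemC : (r1C, r2C) ∈ Cf D H β0 P xC)
    (hne : r1B ≠ r1C)
    (hsupp : ∀ s ∈ Cf D H β0 P xB ∪ Cf D H β0 P xC,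
      s.2 ≤ (r2B - r2C) / (r1B - r1C) * (s.1 - r1B) + r2B) :
    0 ≤ r1B ∧ r1B < rb1 ∧ rb1 < r1C ∧
    0 ≤ r2C ∧ r2C < rb2 ∧ rb2 < r2B := by
  set aB := h1 D H β0 xB
  set bB := h2 D H β0 xB
  set aC := h1 D H β0 xC
  set bC := h2 D H β0 xC
  have haB : 0 < aB := h1_pos hH hβ D xB
  have hbB : 0 < bB := h2_pos hH hβ D xB
  have haC : 0 < aC := h1_pos hH hβ D xC
  have hbC : 0 < bC := h2_pos hH hβ D xC
  have haa : aB < aC := h1_lt_h1 hH hβ hC hCB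
  have hbb : bC < bB := h2_lt_h2 hH hβ hB hCB
  have hLL : Real.logb 2 (1 + P * aB) < Real.logb 2 (1 + P * aC) :=
    Real.logb_lt_logb one_lt_two (by positivity) (by nlinarith)
  set LB := Real.logb 2 (1 + P * aB)
  set LC := Real.logb 2 (1 + P * aC)
  have hantiB : StrictAntiOn (bd aB bB P) (Set.Iic LB) := strictAntiOn_bd haB hbB hP
  have hantiC : StrictAntiOn (bd aC bC P) (Set.Iic LC) := strictAntiOn_bd haC hbC hP
  have hdiff : ContinuousOn (fun s => bd aB bB P s - bd aC bC P s) (Set.Iic LB) :=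
    (continuousOn_bd haB hbB hP).sub
      ((continuousOn_bd haC hbC hP).mono (Set.Iic_subset_Iic.2 hLL.le))
  have hR2B : ∀ s, 0 ≤ s → s ≤ LB → R2 D H β0 P xB s = bd aB bB P s := fun s h0 h =>
    R2_eq_bd hH hβ hP h0 h
  have hR2C : ∀ s, 0 ≤ s → s ≤ LB → R2 D H β0 P xC s = bd aC bC P s := fun s h0 h =>
    R2_eq_bd hH hβ hP h0 (h.trans hLL.le)
  rw [hR2B rb1 hrb1_pos.le hrb1_lt.le] at hint hrb2
  rw [hR2C rb1 hrb1_pos.le hrb1_lt.le] at hint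
  have huniq' : ∀ s, 0 < s → s < LB → bd aB bB P s - bd aC bC P s = 0 → s = rb1 := by
    intro s h0 h hs
    refine huniq s h0 h ?_
    rw [hR2B s h0.le h.le, hR2C s h0.le h.le]
    exact sub_eq_zero.1 hs
  have hdiff_zero : 0 < bd aB bB P 0 - bd aC bC P 0 := by
    rw [bd_zero haB, bd_zero haC, sub_pos]
    exact Real.logb_lt_logb one_lt_two (by positivity) (by nlinarith)
  have hdiff_end : bd aB bB P LB - bd aC bC P LB < 0 := by
    have h := hantiC (Set.mem_Iic.2 hLL.le) (Set.mem_Iic.2 le_rfl) hLL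
    rw [bd_logb haC hbC hP] at h
    rw [bd_logb haB hbB hP]
    linarith
  obtain ⟨h1B_nonneg, h1B_le, h2B_nonneg, h2B_le⟩ := (mem_Cf_iff_le_bd hH hβ hP).1 hmemB
  obtain ⟨h1C_nonneg, h1C_le, h2C_nonneg, h2C_le⟩ := (mem_Cf_iff_le_bd hH hβ hP).1 hmemC
  set k := (r2B - r2C) / (r1B - r1C) with hk
  have hkC : k * (r1C - r1B) + r2B = r2C := by
    have := sub_ne_zero.2 hne
    rw [hk]
    field_simp
    ring
  have hlineB : ∀ s, 0 ≤ s → s ≤ LB → bd aB bB P s ≤ k * (s - r1B) + r2B := fun s h0 h =>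
    hsupp (s, bd aB bB P s) <| Or.inl <|
      (mem_Cf_iff_le_bd hH hβ hP).2 ⟨h0, h, bd_nonneg haB hbB hP h, le_rfl⟩
  have hlineC : ∀ s, 0 ≤ s → s ≤ LC → bd aC bC P s ≤ k * (s - r1B) + r2B := fun s h0 h =>
    hsupp (s, bd aC bC P s) <| Or.inr <|
      (mem_Cf_iff_le_bd hH hβ hP).2 ⟨h0, h, bd_nonneg haC hbC hP h, le_rfl⟩
  have h2B_eq : r2B = bd aB bB P r1B := by
    have := hlineB r1B h1B_nonneg h1B_le
    rw [sub_self, mul_zero, zero_add] at this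
    exact le_antisymm h2B_le this
  have h2C_eq : r2C = bd aC bC P r1C := by
    have := hlineC r1C h1C_nonneg h1C_le
    rw [hkC] at this
    exact le_antisymm h2C_le this
  have hB_le : r1B ≤ rb1 := by
    by_contra! hlt
    have h0 : 0 ≤ bd aB bB P r1B - bd aC bC P r1B := by
      have := hlineC r1B h1B_nonneg (h1B_le.trans hLL.le)
      rw [sub_self, mul_zero, zero_add] at this
      linarith
    obtain ⟨s, hs, hs0⟩ := intermediate_value_Icc' h1B_le
      (hdiff.mono Set.Icc_subset_Iic_self) ⟨hdiff_end.le, h0⟩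
    dsimp only at hs0
    have hsL : s < LB := hs.2.lt_of_ne (by rintro rfl; linarith)
    have := huniq' s (by linarith [hs.1]) hsL hs0
    linarith [hs.1]
  have hC_ge : rb1 ≤ r1C := by
    by_contra! hlt
    have h0 : bd aB bB P r1C - bd aC bC P r1C ≤ 0 := by
      have := hlineB r1C h1C_nonneg (hlt.trans hrb1_lt).le
      linarith
    obtain ⟨s, hs, hs0⟩ := intermediate_value_Icc' h1C_nonneg
      (hdiff.mono fun y hy => hy.2.trans (hlt.trans hrb1_lt).le) ⟨h0, hdiff_zero.le⟩
    dsimp only at hs0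
    have hs_pos : 0 < s := hs.1.lt_of_ne (by rintro rfl; linarith)
    have := huniq' s hs_pos (by linarith [hs.2]) hs0
    linarith [hs.2]
  have hnot_touch : bd aB bB P rb1 ≠ k * (rb1 - r1B) + r2B := by
    intro htouch
    have hlt := hrb1_lt.trans hLL
    have hB' := (hasDerivAt_bd haB hbB hP hrb1_lt.le).eq_slope_of_le_line
      (k := k) (c := r2B - k * r1B) hrb1_pos hrb1_lt (by linarith)
      fun s hs => by linarith [hlineB s hs.1.le hs.2.le]
    have hC' := (hasDerivAt_bd haC hbC hP hlt.le).eq_slope_of_le_line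
      (k := k) (c := r2B - k * r1B) hrb1_pos hlt (by linarith)
      fun s hs => by linarith [hlineC s hs.1.le hs.2.le]
    have hslope := bd_slope_lt_of_bd_eq haB hbC hP haa hbb hrb1_lt.le hlt.le hint
    have := mul_lt_mul_of_pos_left hslope (Real.rpow_pos_of_pos two_pos rb1)
    linarith
  have hB_lt : r1B < rb1 := by
    refine hB_le.lt_of_ne fun h => hnot_touch ?_
    rw [← h, ← h2B_eq]
    ring
  have hC_gt : rb1 < r1C := by
    refine hC_ge.lt_of_ne fun h => hnot_touch ?_
    rw [hint, h, ← h2C_eq, hkC]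
  refine ⟨h1B_nonneg, hB_lt, hC_gt, h2C_nonneg, ?_, ?_⟩
  · rw [h2C_eq, hrb2, hint]
    exact hantiC (Set.mem_Iic.2 (hrb1_lt.trans hLL).le) h1C_le hC_gt
  · rw [h2B_eq, hrb2]
    exact hantiB h1B_le (Set.mem_Iic.2 hrb1_lt.le) hB_lt
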